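/- Let f, g : FIN_A → C be colorings into a finite set C. If g is uniformly recurrent and weakly proximal to f, then g is strongly proximal to f. -/

import Mathlib

namespace Carlson

/-- The domain of a partial function `ℕ →. B`, encoded as `ℕ → Option B`. -/
def dom {B : Type*} (p : ℕ → Option B) : Set ℕ := {n | p n ≠ none}

/-- `p` is a located word over `B`: a partial function with finite nonempty domain. -/
def IsLW {B : Type*} (p : ℕ → Option B) : Prop := (dom p).Finite ∧ (dom p).Nonempty

/-- A located variable word over `A` is a located word over `Option A`
(where `none` encodes the variable `⋆`) taking the value `⋆` at least once. -/
def IsLVW {A : Type*} (p : ℕ → Option (Option A)) : Prop :=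
  IsLW p ∧ ∃ n, p n = some none

/-- `p < q`: every element of the domain of `p` is below every element of the domain of `q`. -/
def blt {B : Type*} (p q : ℕ → Option B) : Prop :=
  ∀ m ∈ dom p, ∀ n ∈ dom q, m < n

/-- Union `p ∪ q` of two partial functions (`p` takes precedence; for `blt p q`
the domains are disjoint, so this is the genuine union). -/
def pun {B : Type*} (p q : ℕ → Option B) : ℕ → Option B :=
  fun n => (p n).elim (q n) some

/-- The empty partial function. -/
def emptyW {B : Type*} : ℕ → Option B := fun _ => none

/-- `p[a]`: substitution of the letter `a ∈ A` for the variable `⋆` in a located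
variable word. -/
def substA {A : Type*} (p : ℕ → Option (Option A)) (a : A) : ℕ → Option A :=
  fun n => (p n).map fun x => x.getD a

/-- `p[a]` for `a ∈ A ∪ {⋆}` (with `none` encoding `⋆`, so `p[⋆] = p`). -/
def substV {A : Type*} (p : ℕ → Option (Option A)) (a : Option A) : ℕ → Option (Option A) :=
  fun n => (p n).map fun x => x.elim a some

/-- Union of a finite family of partial functions with pairwise disjoint domains. -/
def famUnion {B : Type*} {k : ℕ} (g : Fin k → ℕ → Option B) : ℕ → Option B :=
  fun n => ((List.ofFn fun i => g i n).filterMap id).head?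

/-- A block sequence: a set of located variable words totally ordered by `<`. -/
def IsBlockSeq {A : Type*} (X : Set (ℕ → Option (Option A))) : Prop :=
  (∀ p ∈ X, IsLVW p) ∧ ∀ p ∈ X, ∀ q ∈ X, p = q ∨ blt p q ∨ blt q p

/-- `[X]_A`: located words of the form `p₀[a₀] ∪ ⋯ ∪ p_k[a_k]` with `p₀ < ⋯ < p_k`
all in `X` and `a₀, …, a_k ∈ A`. -/
def combA {A : Type*} (X : Set (ℕ → Option (Option A))) : Set (ℕ → Option A) :=
  { q | ∃ (k : ℕ) (p : Fin (k + 1) → ℕ → Option (Option A)) (a : Fin (k + 1) → A),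
      (∀ i, p i ∈ X) ∧ (∀ i j : Fin (k + 1), i < j → blt (p i) (p j)) ∧
      q = famUnion fun i => substA (p i) (a i) }

/-- `[X]_{A⋆}`: located variable words of the form `p₀[a₀] ∪ ⋯ ∪ p_k[a_k]` with
`p₀ < ⋯ < p_k` all in `X`, `a₀, …, a_k ∈ A ∪ {⋆}`, and `⋆` used at least once. -/
def combV {A : Type*} (X : Set (ℕ → Option (Option A))) : Set (ℕ → Option (Option A)) :=
  { q | ∃ (k : ℕ) (p : Fin (k + 1) → ℕ → Option (Option A)) (a : Fin (k + 1) → Option A),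
      (∀ i, p i ∈ X) ∧ (∀ i j : Fin (k + 1), i < j → blt (p i) (p j)) ∧
      (∃ i, a i = none) ∧ q = famUnion fun i => substV (p i) (a i) }

/-- `X − F`: the elements of `X` whose domain lies entirely above the domains of
all members of `F`. -/
def sminus {B : Type*} (X F : Set (ℕ → Option B)) : Set (ℕ → Option B) :=
  { q ∈ X | ∀ p ∈ F, blt p q }

/-- `dom q ⊆ [0, ℓ)`. -/
def domBelow {B : Type*} (q : ℕ → Option B) (ℓ : ℕ) : Prop := ∀ n ∈ dom q, n < ℓ

/-- `dom q ⊆ [m, ∞)`. -/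
def domAbove {B : Type*} (q : ℕ → Option B) (m : ℕ) : Prop := ∀ n ∈ dom q, m ≤ n

/-- `S^ℓ_p(f) = S^ℓ_{p'}(g)` for colorings of located words: agreement at `q ∪ p`
vs `q ∪ p'` for every located word `q` with domain contained in `[0, ℓ)`.
(Take `p' = emptyW` to express `S^ℓ_p(f) = S^ℓ(g)`.) -/
def SEq {A C : Type*} (f g : (ℕ → Option A) → C) (ℓ : ℕ) (p p' : ℕ → Option A) : Prop :=
  ∀ q : ℕ → Option A, IsLW q → domBelow q ℓ → f (pun q p) = g (pun q p')

/-- Variant of `SEq` for colorings that are also defined at the empty located word,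
i.e. `q` ranges over `FIN_A(0, ℓ) ∪ {∅}`. -/
def SEq0 {A C : Type*} (f g : (ℕ → Option A) → C) (ℓ : ℕ) (p p' : ℕ → Option A) : Prop :=
  ∀ q : ℕ → Option A, (dom q).Finite → domBelow q ℓ → f (pun q p) = g (pun q p')

/-- A coloring `f` is recurrent if for every `ℓ` there is a located variable word `p`
with domain in `[ℓ, ∞)` such that `S^ℓ_{p[a]}(f) = S^ℓ(f)` for every `a ∈ A`. -/
def Recurrent {A C : Type*} (f : (ℕ → Option A) → C) : Prop :=
  ∀ ℓ : ℕ, ∃ p : ℕ → Option (Option A), IsLVW p ∧ domAbove p ℓ ∧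
    ∀ a : A, SEq f f ℓ (substA p a) emptyW

/-- A coloring `f` is uniformly recurrent if for every `ℓ` there is `m > ℓ` such that
for every `p ∈ FIN_A(m, ∞)` there is `q ∈ FIN_A(ℓ, m)` with `S^ℓ_{q ∪ p}(f) = S^ℓ(f)`. -/
def UnifRecurrent {A C : Type*} (f : (ℕ → Option A) → C) : Prop :=
  ∀ ℓ : ℕ, ∃ m : ℕ, ℓ < m ∧ ∀ p : ℕ → Option A, IsLW p → domAbove p m →
    ∃ q : ℕ → Option A, IsLW q ∧ domAbove q ℓ ∧ domBelow q m ∧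
      SEq f f ℓ (pun q p) emptyW

/-- `f` and `g` are weakly proximal: for every `ℓ` there is `p ∈ FIN_A(ℓ, ∞)` with
`S^ℓ_p(f) = S^ℓ_p(g)`. -/
def WeakProx {A C : Type*} (f g : (ℕ → Option A) → C) : Prop :=
  ∀ ℓ : ℕ, ∃ p : ℕ → Option A, IsLW p ∧ domAbove p ℓ ∧ SEq f g ℓ p p

/-- `g` is strongly proximal to `f`: for every `ℓ` there is a located variable word `p`
with domain in `[ℓ, ∞)` such that `S^ℓ(g) = S^ℓ_{p[a]}(g) = S^ℓ_{p[a]}(f)` for all `a ∈ A`. -/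
def StrongProx {A C : Type*} (g f : (ℕ → Option A) → C) : Prop :=
  ∀ ℓ : ℕ, ∃ p : ℕ → Option (Option A), IsLVW p ∧ domAbove p ℓ ∧
    ∀ a : A, SEq g g ℓ emptyW (substA p a) ∧ SEq g f ℓ (substA p a) (substA p a)

/-- `Recurrent` for colorings also defined at the empty located word. -/
def Recurrent0 {A C : Type*} (f : (ℕ → Option A) → C) : Prop :=
  ∀ ℓ : ℕ, ∃ p : ℕ → Option (Option A), IsLVW p ∧ domAbove p ℓ ∧
    ∀ a : A, SEq0 f f ℓ (substA p a) emptyW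

/-- `StrongProx` for colorings also defined at the empty located word. -/
def StrongProx0 {A C : Type*} (g f : (ℕ → Option A) → C) : Prop :=
  ∀ ℓ : ℕ, ∃ p : ℕ → Option (Option A), IsLVW p ∧ domAbove p ℓ ∧
    ∀ a : A, SEq0 g g ℓ emptyW (substA p a) ∧ SEq0 g f ℓ (substA p a) (substA p a)

/-- Agreement of two colorings on all located words with domain in `[0, ℓ)`. -/
def AgreeBelow {A C : Type*} (f g : (ℕ → Option A) → C) (ℓ : ℕ) : Prop :=
  ∀ q : ℕ → Option A, IsLW q → domBelow q ℓ → f q = g q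

/-- Closedness of a class in `C^{FIN_A}` with the product topology (`C` discrete):
a class is closed iff it contains every coloring all of whose finite restrictions
(to located words with domain in `[0, ℓ)`, for each `ℓ`) are matched within the class. -/
def IsClosedColl {A C : Type*} (𝓒 : Set ((ℕ → Option A) → C)) : Prop :=
  ∀ f, (∀ ℓ : ℕ, ∃ g ∈ 𝓒, AgreeBelow f g ℓ) → f ∈ 𝓒

/-- A subshift: a nonempty closed class `𝓒 ⊆ C^{FIN_A}` such that for every `f ∈ 𝓒`,
`ℓ ∈ ℕ` and `p ∈ FIN_A(ℓ, ∞)` there is `g ∈ 𝓒` with `S^ℓ(g) = S^ℓ_p(f)`. -/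
def IsSubshift {A C : Type*} (𝓒 : Set ((ℕ → Option A) → C)) : Prop :=
  𝓒.Nonempty ∧ IsClosedColl 𝓒 ∧
    ∀ f ∈ 𝓒, ∀ ℓ : ℕ, ∀ p : ℕ → Option A, IsLW p → domAbove p ℓ →
      ∃ g ∈ 𝓒, SEq g f ℓ emptyW p

/-- A minimal subshift: no subshift is a proper subset of it. -/
def IsMinimalSubshift {A C : Type*} (𝓒 : Set ((ℕ → Option A) → C)) : Prop :=
  IsSubshift 𝓒 ∧ ∀ 𝓓 : Set ((ℕ → Option A) → C), IsSubshift 𝓓 → 𝓓 ⊆ 𝓒 → 𝓓 = 𝓒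

/-- The orbit closure of a coloring `f`: all `g` such that for every `ℓ` and every
`q ∈ FIN_A(ℓ, ∞)` there is `p ∈ FIN_A(ℓ, ∞)` with `S^ℓ_q(g) = S^ℓ_p(f)`. -/
def orbCl {A C : Type*} (f : (ℕ → Option A) → C) : Set ((ℕ → Option A) → C) :=
  { g | ∀ ℓ : ℕ, ∀ q : ℕ → Option A, IsLW q → domAbove q ℓ →
      ∃ p : ℕ → Option A, IsLW p ∧ domAbove p ℓ ∧ SEq g f ℓ q p }

/-- A variable word over `A`, encoded as a list over `Option A` with `none` = `⋆`:
the variable must occur at least once. -/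
def IsVarWord {A : Type*} (w : List (Option A)) : Prop := none ∈ w

/-- `w[a]`: replace every occurrence of the variable `⋆` by the letter `a`. -/
def substW {A : Type*} (w : List (Option A)) (a : A) : List A :=
  w.map fun x => x.getD a

/-- `⟨(w_n)_{n∈ℕ}⟩_A`: the words `w_{j₀}[a₀] ⋯ w_{j_{k-1}}[a_{k-1}]` extracted from
the sequence `(w_n)`, for `j₀ < ⋯ < j_{k-1}` and letters `a₀, …, a_{k-1} ∈ A`. -/
def extracted {A : Type*} (w : ℕ → List (Option A)) : Set (List A) :=
  { u | ∃ (k : ℕ) (j : Fin (k + 1) → ℕ) (a : Fin (k + 1) → A),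
      StrictMono j ∧ u = (List.ofFn fun i => substW (w (j i)) (a i)).flatten }

lemma pun_assoc {B : Type*} (p q r : ℕ → Option B) :
    pun (pun p q) r = pun p (pun q r) := by
  funext n
  cases h : p n <;> simp [pun, h]

@[simp] lemma pun_emptyW {B : Type*} (p : ℕ → Option B) : pun p emptyW = p := by
  funext n
  cases h : p n <;> simp [pun, emptyW, h]

lemma dom_pun {B : Type*} (p q : ℕ → Option B) : dom (pun p q) = dom p ∪ dom q := by
  ext n
  cases h : p n <;> simp [dom, pun, h]

lemma IsLW.pun {B : Type*} {p q : ℕ → Option B} (hp : IsLW p) (hq : IsLW q) :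
    IsLW (pun p q) := by
  simp only [IsLW, dom_pun]
  exact ⟨hp.1.union hq.1, hp.2.inl⟩

lemma domAbove.pun {B : Type*} {p q : ℕ → Option B} {m : ℕ} (hp : domAbove p m)
    (hq : domAbove q m) : domAbove (pun p q) m := by
  simp only [domAbove, dom_pun]
  rintro n (h | h)
  exacts [hp n h, hq n h]

lemma domBelow.pun {B : Type*} {p q : ℕ → Option B} {m : ℕ} (hp : domBelow p m)
    (hq : domBelow q m) : domBelow (pun p q) m := by
  simp only [domBelow, dom_pun]
  rintro n (h | h)
  exacts [hp n h, hq n h]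

lemma domAbove.mono {B : Type*} {p : ℕ → Option B} {m k : ℕ} (hp : domAbove p m)
    (h : k ≤ m) : domAbove p k := fun n hn => h.trans (hp n hn)

lemma domBelow.mono {B : Type*} {p : ℕ → Option B} {m k : ℕ} (hp : domBelow p m)
    (h : m ≤ k) : domBelow p k := fun n hn => (hp n hn).trans_le h

/-- A located word over `A`, viewed as a word over `A ∪ {⋆}`. -/
def lift {A : Type*} (p : ℕ → Option A) : ℕ → Option (Option A) := fun n => (p n).map some

@[simp] lemma dom_lift {A : Type*} (p : ℕ → Option A) : dom (lift p) = dom p := by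
  ext n
  simp [dom, lift]

@[simp] lemma substA_lift {A : Type*} (p : ℕ → Option A) (a : A) : substA (lift p) a = p := by
  funext n
  cases h : p n <;> simp [substA, lift, h]

lemma substA_pun {A : Type*} (p q : ℕ → Option (Option A)) (a : A) :
    substA (pun p q) a = pun (substA p a) (substA q a) := by
  funext n
  cases h : p n <;> simp [substA, pun, h]

/-- The word of length `N`, located on the interval `[m, m + N)`. -/
def place {B : Type*} (m : ℕ) {N : ℕ} (v : Fin N → B) : ℕ → Option B := fun n =>
  if h : m ≤ n ∧ n < m + N then some (v ⟨n - m, by omega⟩) else none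

lemma mem_dom_place {B : Type*} {m N : ℕ} {v : Fin N → B} {n : ℕ} :
    n ∈ dom (place m v) ↔ m ≤ n ∧ n < m + N := by
  simp [dom, place]

lemma place_add {B : Type*} {m N : ℕ} (v : Fin N → B) (i : Fin N) :
    place m v (m + i) = some (v i) := by
  simp [place]

lemma isLW_place {B : Type*} {m N : ℕ} (v : Fin N → B) (i : Fin N) : IsLW (place m v) :=
  ⟨(Set.finite_Iio (m + N)).subset fun _ hn => (mem_dom_place.1 hn).2,
    ⟨m + i, mem_dom_place.2 ⟨by omega, by omega⟩⟩⟩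

lemma domAbove_place {B : Type*} {m N : ℕ} (v : Fin N → B) : domAbove (place m v) m :=
  fun _ hn => (mem_dom_place.1 hn).1

lemma domBelow_place {B : Type*} {m N : ℕ} (v : Fin N → B) : domBelow (place m v) (m + N) :=
  fun _ hn => (mem_dom_place.1 hn).2

lemma substA_place {A : Type*} {m N : ℕ} (v : Fin N → Option A) (a : A) :
    substA (place m v) a = place m fun i => (v i).getD a := by
  funext n
  by_cases h : m ≤ n ∧ n < m + N <;> simp [substA, place, h]

/-- The word with domain in `[0, m)` given by a finite table of values. -/
def extend {B : Type*} {m : ℕ} (w : Fin m → Option B) : ℕ → Option B := fun n =>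
  if h : n < m then w ⟨n, h⟩ else none

lemma extend_restrict {B : Type*} {m : ℕ} {p : ℕ → Option B} (hp : domBelow p m) :
    extend (fun i : Fin m => p i) = p := by
  funext n
  by_cases h : n < m
  · simp [extend, h]
  · have : p n = none := by
      by_contra hn
      exact h (hp n hn)
    simp [extend, h, this]

/-- The Hales-Jewett theorem for words on an interval `[m, m + N)`: there is a variable word whose
substitution instances all act in the same way on the located words below `m`, for any coloring
of located words and any tail `s`. -/
lemma exists_uniform_line (A C : Type*) [Finite A] [Finite C] (m : ℕ) :
    ∃ N : ℕ, ∀ (g : (ℕ → Option A) → C) (s : ℕ → Option A),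
      ∃ v : Fin N → Option A, (∃ i, v i = none) ∧ ∀ (a b : A) (q : ℕ → Option A),
        domBelow q m → g (pun q (pun (substA (place m v) a) s)) =
          g (pun q (pun (substA (place m v) b) s)) := by
  obtain ⟨ι, _, hι⟩ := Combinatorics.Line.exists_mono_in_high_dimension A
    ((Fin m → Option A) → C)
  let e := Fintype.equivFin ι
  refine ⟨Fintype.card ι, fun g s => ?_⟩
  obtain ⟨l, c, hc⟩ := hι fun x w => g (pun (extend w) (pun (place m (x ∘ e.symm)) s))
  obtain ⟨i, hi⟩ := l.proper
  refine ⟨l.idxFun ∘ e.symm, ⟨e i, by simp [hi]⟩, fun a b q hq => ?_⟩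
  have h := congrFun ((hc a).trans (hc b).symm) fun i => q i
  simp only [extend_restrict hq] at h
  rw [substA_place, substA_place]
  exact h

/-- If `g` is uniformly recurrent and weakly proximal to `f`, then `g` is strongly
proximal to `f`. -/
theorem strongProx_of_unifRecurrent_weakProx {A C : Type*} [Fintype A] [Nonempty A]
    [Fintype C] (f g : (ℕ → Option A) → C)
    (hur : UnifRecurrent g) (hwp : WeakProx g f) : StrongProx g f := by
  intro ℓ
  obtain ⟨m, hm, hrec⟩ := hur ℓ
  obtain ⟨N, hN⟩ := exists_uniform_line A C m
  obtain ⟨s, hs, hsN, hgf⟩ := hwp (m + N)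
  obtain ⟨v, ⟨i, hi⟩, hv⟩ := hN g s
  have hsm : domAbove s m := hsN.mono (by omega)
  let a₀ : A := Classical.arbitrary A
  obtain ⟨q, hq, hqℓ, hqm, hqg⟩ := hrec (pun (substA (place m v) a₀) s)
    (by rw [substA_place]; exact (isLW_place _ i).pun hs)
    (by rw [substA_place]; exact (domAbove_place _).pun hsm)
  have hsub (a : A) : substA (pun (lift q) (pun (place m v) (lift s))) a =
      pun q (pun (substA (place m v) a) s) := by
    simp [substA_pun]
  have hqlow (n : ℕ) (hn : n ∈ dom (lift q)) : n < m := hqm n (by simpa using hn)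
  refine ⟨pun (lift q) (pun (place m v) (lift s)), ⟨?_, m + i, ?_⟩, ?_, fun a => ⟨?_, ?_⟩⟩
  · exact IsLW.pun (by simpa [IsLW] using hq)
      ((isLW_place _ i).pun (by simpa [IsLW] using hs))
  · have h : lift q (m + i) = none := by
      by_contra hn
      have := hqlow _ hn
      omega
    simp [pun, h, place_add, hi]
  · exact domAbove.pun (by simpa [domAbove] using hqℓ)
      (((domAbove_place v).mono hm.le).pun
        (by simpa [domAbove] using hsm.mono hm.le))
  · intro r hr hrℓ
    have hrq : domBelow (pun r q) m := (hrℓ.mono hm.le).pun hqm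
    rw [hsub, ← hqg r hr hrℓ, ← pun_assoc r, ← pun_assoc r]
    exact hv a₀ a _ hrq
  · intro r hr hrℓ
    have hrq : domBelow (pun r q) m := (hrℓ.mono hm.le).pun hqm
    rw [hsub, ← pun_assoc r, ← pun_assoc (pun r q), substA_place]
    exact hgf _ ((hr.pun hq).pun (isLW_place _ i))
      ((hrq.mono (by omega)).pun (domBelow_place _))

end Carlson
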